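/- arXiv:2109.07375 — 3 statements merged into one kernel-verified Lean document; each statement's English description precedes it below -/
import Mathlib

section
/- For each n ≥ 1, let r_n : ℤ_{≥1} → [0,1] be a nonincreasing function with r_n(1) = 1, define λ_i(n) := −Σ_{k=1}^∞ r_n(k)·( log(1 − 1/(k+n)) + 1/(k+n−i) ) for 1 ≤ i ≤ n, and define c(n) := Σ_{k=1}^∞ r_n(k)/(k+n−1)². Let m : ℤ_{≥1} → ℤ_{≥1} satisfy 1 ≤ m(n) ≤ n and m(n)/√n → 0 as n → ∞. Then sup_{1 ≤ i ≤ m(n)} | c(n)^{−1}·(λ_i(n) − λ_1(n)) + (i − 1) | → 0 as n → ∞; that is, c(n)^{−1}(λ_i(n) − λ_1(n)) = −i + 1 + o(1) uniformly for 1 ≤ i ≤ m(n). -/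
open MeasureTheory ProbabilityTheory Matrix Filter

noncomputable section

/-- The Lyapunov exponent `λ_i(n) = -∑_{k≥1} r(k) (log(1 - 1/(k+n)) + 1/(k+n-i))`,
for a tail-frequency function `r` (indexed so that the sum below is over `k = 1, 2, …`). -/
def lam (r : ℕ → ℝ) (n i : ℕ) : ℝ :=
  -∑' k : ℕ, r (k + 1) *
    (Real.log (1 - 1 / ((k : ℝ) + 1 + n)) + 1 / ((k : ℝ) + 1 + n - i))

/-- The constant `c(n) = ∑_{k≥1} r(k)/(k+n-1)²`. -/
def cn (r : ℕ → ℝ) (n : ℕ) : ℝ := ∑' k : ℕ, r (k + 1) / ((k : ℝ) + n) ^ 2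

/-- The terms `r (k + 1) / (k + n) ^ 2` of `cn` are summable for a bounded `r`. -/
theorem summable_cn {r : ℕ → ℝ} (hr : ∀ k, 1 ≤ k → r k ∈ Set.Icc (0 : ℝ) 1) {n : ℕ} (hn : 1 ≤ n) :
    Summable fun k : ℕ => r (k + 1) / ((k : ℝ) + n) ^ 2 := by
  have hn' : (1 : ℝ) ≤ n := by exact_mod_cast hn
  have hs : Summable fun k : ℕ => 1 / ((k : ℝ) + n) ^ 2 := by
    have := (summable_nat_add_iff n).mpr (Real.summable_one_div_nat_pow.mpr one_lt_two)
    simpa using this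
  refine hs.of_nonneg_of_le (fun k => ?_) fun k => ?_
  · exact div_nonneg (hr _ (by omega)).1 (by positivity)
  · exact div_le_div_of_nonneg_right (hr _ (by omega)).2 (by positivity)

/-- The terms of the series defining `lam r n 1` are summable for a bounded `r`. -/
theorem summable_lam_one {r : ℕ → ℝ} (hr : ∀ k, 1 ≤ k → r k ∈ Set.Icc (0 : ℝ) 1) {n : ℕ}
    (hn : 1 ≤ n) :
    Summable fun k : ℕ => r (k + 1) *
      (Real.log (1 - 1 / ((k : ℝ) + 1 + n)) + 1 / ((k : ℝ) + 1 + n - (1 : ℕ))) := by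
  have hn' : (1 : ℝ) ≤ n := by exact_mod_cast hn
  have key : ∀ k : ℕ, 0 ≤ Real.log (1 - 1 / ((k : ℝ) + 1 + n)) + 1 / ((k : ℝ) + 1 + n - (1 : ℕ)) ∧
      Real.log (1 - 1 / ((k : ℝ) + 1 + n)) + 1 / ((k : ℝ) + 1 + n - (1 : ℕ))
        ≤ 1 / ((k : ℝ) + n) ^ 2 := by
    intro k
    obtain ⟨x, hx⟩ : ∃ x : ℝ, x = k + n := ⟨_, rfl⟩
    have hx0 : 0 < x := by rw [hx]; positivity
    have e1 : (k : ℝ) + 1 + n = x + 1 := by rw [hx]; ring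
    have e2 : (k : ℝ) + 1 + n - (1 : ℕ) = x := by rw [hx]; push_cast; ring
    have e3 : 1 - 1 / (x + 1) = x / (x + 1) := by field_simp; ring
    have hpos : 0 < x / (x + 1) := by positivity
    rw [e2, e1, ← hx, e3]
    have h1 := Real.one_sub_inv_le_log_of_pos hpos
    have h2 := Real.log_le_sub_one_of_pos hpos
    have h3 : 1 - (x / (x + 1))⁻¹ = -(1 / x) := by field_simp; ring
    have h4 : x / (x + 1) - 1 + 1 / x ≤ 1 / x ^ 2 := by
      have : x / (x + 1) - 1 + 1 / x = 1 / (x * (x + 1)) := by field_simp; ring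
      rw [this]
      exact one_div_le_one_div_of_le (by positivity) (by nlinarith)
    constructor <;> linarith
  refine (summable_cn hr hn).of_nonneg_of_le (fun k => ?_) fun k => ?_
  · exact mul_nonneg (hr _ (by omega)).1 (key k).1
  · rw [div_eq_mul_one_div (r (k + 1))]
    exact mul_le_mul_of_nonneg_left (key k).2 (hr _ (by omega)).1

theorem cn_pos {r : ℕ → ℝ} (hr : ∀ k, 1 ≤ k → r k ∈ Set.Icc (0 : ℝ) 1) (hr1 : r 1 = 1) {n : ℕ}
    (hn : 1 ≤ n) : 0 < cn r n := by
  have hn' : (1 : ℝ) ≤ n := by exact_mod_cast hn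
  refine (summable_cn hr hn).tsum_pos (fun k => ?_) 0 ?_
  · exact div_nonneg (hr _ (by omega)).1 (by positivity)
  · simp only [zero_add, hr1]
    positivity

/-- Non-asymptotic form of the expansion of `λ_i(n) - λ_1(n)`. -/
theorem abs_inv_cn_mul_lam_sub_add_le {r : ℕ → ℝ} (hr : ∀ k, 1 ≤ k → r k ∈ Set.Icc (0 : ℝ) 1)
    (hr1 : r 1 = 1) {n i : ℕ} (hn : 1 ≤ n) (hin : i ≤ n) :
    |(cn r n)⁻¹ * (lam r n i - lam r n 1) + ((i : ℝ) - 1)|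
      ≤ ((i : ℝ) - 1) ^ 2 / ((n : ℝ) + 1 - i) := by
  have hn' : (1 : ℝ) ≤ n := by exact_mod_cast hn
  have hin' : (i : ℝ) ≤ n := by exact_mod_cast hin
  have hd : (0 : ℝ) < n + 1 - i := by linarith
  have hc := cn_pos hr hr1 hn
  have ha := summable_cn hr hn
  set a : ℕ → ℝ := fun k => r (k + 1) / ((k : ℝ) + n) ^ 2
  have ha0 : ∀ k, 0 ≤ a k := fun k => div_nonneg (hr _ (by omega)).1 (by positivity)
  let b : ℕ → ℝ := fun k => a k / ((k : ℝ) + n + 1 - i)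
  have hden : ∀ k : ℕ, (n : ℝ) + 1 - i ≤ (k : ℝ) + n + 1 - i := fun k => by
    linarith [(Nat.cast_nonneg k : (0 : ℝ) ≤ k)]
  have hb0 : ∀ k, 0 ≤ b k := fun k => div_nonneg (ha0 k) (hd.le.trans (hden k))
  have hba : ∀ k, b k ≤ a k / ((n : ℝ) + 1 - i) := fun k =>
    div_le_div_of_nonneg_left (ha0 k) hd (hden k)
  have hb : Summable b := (ha.div_const _).of_nonneg_of_le hb0 hba
  have hB : ∑' k, b k ≤ cn r n / ((n : ℝ) + 1 - i) := by
    rw [cn, ← tsum_div_const]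
    exact hb.tsum_le_tsum hba (ha.div_const _)
  have hlam : lam r n i
      = lam r n 1 - (((i : ℝ) - 1) * cn r n + ((i : ℝ) - 1) ^ 2 * ∑' k, b k) := by
    have hf := summable_lam_one hr hn
    rw [lam, lam, cn, ← tsum_mul_left, ← tsum_mul_left,
      ← (ha.mul_left _).tsum_add (hb.mul_left _), sub_eq_add_neg, ← neg_add,
      ← hf.tsum_add ((ha.mul_left _).add (hb.mul_left _))]
    congr 2
    funext k
    have hx : 0 < (k : ℝ) + n := by positivity
    have hy : 0 < (k : ℝ) + n + 1 - i := hd.trans_le (hden k)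
    have e1 : (k : ℝ) + 1 + n - i = (k : ℝ) + n + 1 - i := by ring
    have e2 : (k : ℝ) + 1 + n - (1 : ℕ) = k + n := by push_cast; ring
    have e3 : 1 / ((k : ℝ) + n + 1 - i) = 1 / ((k : ℝ) + n) + ((i : ℝ) - 1) / ((k : ℝ) + n) ^ 2
        + ((i : ℝ) - 1) ^ 2 / ((k : ℝ) + n) ^ 2 / ((k : ℝ) + n + 1 - i) := by
      field_simp
      ring
    simp only [b, a]
    rw [e1, e2, e3]
    ring
  have hB0 : 0 ≤ ∑' k, b k := tsum_nonneg hb0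
  have heq : (cn r n)⁻¹ * (lam r n i - lam r n 1) + ((i : ℝ) - 1)
      = -(((i : ℝ) - 1) ^ 2 * ((∑' k, b k) / cn r n)) := by
    rw [hlam]
    field_simp
    ring
  rw [heq, abs_neg, abs_of_nonneg (by positivity),
    div_eq_mul_one_div (((i : ℝ) - 1) ^ 2)]
  refine mul_le_mul_of_nonneg_left ?_ (sq_nonneg _)
  rw [div_le_iff₀ hc]
  exact hB.trans_eq (by ring)

/-- If `m(n) = o(√n)`, then `c(n)⁻¹ (λ_i(n) - λ_1(n)) = -i + 1 + o(1)`
uniformly over `1 ≤ i ≤ m(n)`. -/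
theorem picket_fence_uniform_absolute_error
    (r : ℕ → ℕ → ℝ)
    (hr01 : ∀ n k : ℕ, 1 ≤ n → 1 ≤ k → r n k ∈ Set.Icc (0 : ℝ) 1)
    (hrmono : ∀ n : ℕ, 1 ≤ n → ∀ k j : ℕ, 1 ≤ k → k ≤ j → r n j ≤ r n k)
    (hr1 : ∀ n : ℕ, 1 ≤ n → r n 1 = 1)
    (m : ℕ → ℕ) (hm1 : ∀ n, 1 ≤ m n) (hmn : ∀ n, 1 ≤ n → m n ≤ n)
    (hmo : Tendsto (fun n : ℕ => (m n : ℝ) / Real.sqrt n) atTop (nhds 0)) :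
    Tendsto (fun n : ℕ =>
      (Finset.Icc 1 (m n)).sup' (Finset.nonempty_Icc.mpr (hm1 n)) (fun i =>
        |(cn (r n) n)⁻¹ * (lam (r n) n i - lam (r n) n 1) + ((i : ℝ) - 1)|))
      atTop (nhds 0) := by
  have hlim : Tendsto (fun n : ℕ => 2 * ((m n : ℝ) / Real.sqrt n) ^ 2) atTop (nhds 0) := by
    simpa using (hmo.pow 2).const_mul 2
  refine squeeze_zero' (Eventually.of_forall fun n => ?_) ?_ hlim
  · exact (abs_nonneg _).trans (Finset.le_sup' (fun i : ℕ =>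
      |(cn (r n) n)⁻¹ * (lam (r n) n i - lam (r n) n 1) + ((i : ℝ) - 1)|)
      (Finset.left_mem_Icc.mpr (hm1 n)))
  filter_upwards [eventually_ge_atTop 1, hmo.eventually_lt_const (by norm_num : (0 : ℝ) < 1 / 2)]
    with n hn ht
  refine Finset.sup'_le _ _ fun i hi => ?_
  obtain ⟨hi1, him⟩ := Finset.mem_Icc.mp hi
  refine (abs_inv_cn_mul_lam_sub_add_le (hr01 n · hn) (hr1 n hn) hn
    (him.trans (hmn n hn))).trans ?_
  have hn' : (1 : ℝ) ≤ n := by exact_mod_cast hn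
  have hi1' : (1 : ℝ) ≤ i := by exact_mod_cast hi1
  have him' : (i : ℝ) ≤ m n := by exact_mod_cast him
  have hm1' : (1 : ℝ) ≤ m n := by exact_mod_cast hm1 n
  have hm2 : (m n : ℝ) ≤ n / 2 := by
    rw [div_lt_iff₀ (Real.sqrt_pos.mpr (by linarith))] at ht
    nlinarith [Real.sq_sqrt (by linarith : (0 : ℝ) ≤ n)]
  rw [div_pow, Real.sq_sqrt (by linarith)]
  calc ((i : ℝ) - 1) ^ 2 / ((n : ℝ) + 1 - i) ≤ (m n : ℝ) ^ 2 / ((n : ℝ) / 2) :=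
        div_le_div₀ (by positivity) (pow_le_pow_left₀ (by linarith) (by linarith) 2)
          (by linarith) (by linarith)
    _ = 2 * ((m n : ℝ) ^ 2 / n) := by field_simp

end
end

section
/- For each n ≥ 1, let r_n : ℤ_{≥1} → [0,1] be a nonincreasing function with r_n(1) = 1, define λ_i(n) := −Σ_{k=1}^∞ r_n(k)·( log(1 − 1/(k+n)) + 1/(k+n−i) ) for 1 ≤ i ≤ n, and define c(n) := Σ_{k=1}^∞ r_n(k)/(k+n−1)². Let m : ℤ_{≥1} → ℤ_{≥1} satisfy 2 ≤ m(n) ≤ n and m(n)/n → 0 as n → ∞. Then sup_{2 ≤ i ≤ m(n)} | c(n)^{−1}·(λ_i(n) − λ_1(n)) / (−(i−1)) − 1 | → 0 as n → ∞; that is, c(n)^{−1}(λ_i(n) − λ_1(n)) = (−i+1)(1 + o(1)) uniformly for 2 ≤ i ≤ m(n). -/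
open MeasureTheory ProbabilityTheory Matrix Filter

noncomputable section

/-- The summands of `lam` are nonnegative and at most `i / (y (y - i))` with `y = k + 1 + n`. -/
theorem log_add_inv_mem_Icc {y i : ℝ} (hi : 1 ≤ i) (hy : i < y) :
    Real.log (1 - 1 / y) + 1 / (y - i) ∈ Set.Icc 0 (i / (y * (y - i))) := by
  have hy0 : 0 < y := by linarith
  have hy1 : 0 < y - 1 := by linarith
  have hyi : 0 < y - i := by linarith
  have hpos : 0 < 1 - 1 / y := by
    rw [show 1 - 1 / y = (y - 1) / y by field_simp]
    positivity
  constructor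
  · have h := Real.one_sub_inv_le_log_of_pos hpos
    have h1 : 1 - (1 - 1 / y)⁻¹ = -(1 / (y - 1)) := by
      rw [show 1 - 1 / y = (y - 1) / y by field_simp, inv_div]
      field_simp
      ring
    have h2 : 1 / (y - 1) ≤ 1 / (y - i) := one_div_le_one_div_of_le hyi (by linarith)
    linarith
  · have h := Real.log_le_sub_one_of_pos hpos
    have h1 : i / (y * (y - i)) = 1 / (y - i) - 1 / y := by
      field_simp
      ring
    linarith

theorem summable_inv_nat_add_one_sq : Summable fun k : ℕ => 1 / ((k : ℝ) + 1) ^ 2 := by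
  have h := (summable_nat_add_iff 1).mpr (Real.summable_one_div_nat_pow.mpr one_lt_two)
  simpa using h

theorem summable_lam {r : ℕ → ℝ} (hr : ∀ k, 1 ≤ k → r k ∈ Set.Icc (0 : ℝ) 1) {n i : ℕ}
    (hi : 1 ≤ i) (hin : i ≤ n) :
    Summable fun k : ℕ => r (k + 1) *
      (Real.log (1 - 1 / ((k : ℝ) + 1 + n)) + 1 / ((k : ℝ) + 1 + n - i)) := by
  have hi' : (1 : ℝ) ≤ i := by exact_mod_cast hi
  have hin' : (i : ℝ) ≤ n := by exact_mod_cast hin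
  refine Summable.of_nonneg_of_le (fun k => ?_) (fun k => ?_)
    (summable_inv_nat_add_one_sq.mul_left (i : ℝ))
  all_goals
    have hk : (0 : ℝ) ≤ k := k.cast_nonneg
    obtain ⟨h0, h1⟩ := hr (k + 1) (by omega)
    obtain ⟨hl, hu⟩ := log_add_inv_mem_Icc hi' (show (i : ℝ) < (k : ℝ) + 1 + n by linarith)
  · exact mul_nonneg h0 hl
  · refine (mul_le_of_le_one_left hl h1).trans (hu.trans ?_)
    rw [mul_one_div, sq]
    gcongr <;> linarith

/-- The difference quotient `(λ_1(n) - λ_i(n)) / (i - 1)` lies between `c(n)` and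
`(1 + (i - 1) / (n - (i - 1))) c(n)`. -/
theorem abs_lam_sub_lam_div_sub_one_le {r : ℕ → ℝ}
    (hr : ∀ k, 1 ≤ k → r k ∈ Set.Icc (0 : ℝ) 1) (hr1 : r 1 = 1) {n i : ℕ}
    (hi : 2 ≤ i) (hin : i ≤ n) :
    |(cn r n)⁻¹ * (lam r n i - lam r n 1) / (-((i : ℝ) - 1)) - 1| ≤
      ((i : ℝ) - 1) / (n - (i - 1)) := by
  have hi' : (2 : ℝ) ≤ i := by exact_mod_cast hi
  have hin' : (i : ℝ) ≤ n := by exact_mod_cast hin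
  have hc := cn_pos hr hr1 (show 1 ≤ n by omega)
  have hs := summable_cn hr (show 1 ≤ n by omega)
  have hsi := summable_lam hr (show 1 ≤ i by omega) hin
  have hs1 := summable_lam hr le_rfl (show 1 ≤ n by omega)
  obtain ⟨j, hj⟩ : ∃ j : ℝ, j = (i : ℝ) - 1 := ⟨_, rfl⟩
  have hj0 : 0 < j := by linarith
  have hjn : 0 < (n : ℝ) - j := by linarith
  have hterm : ∀ k : ℕ, r (k + 1) *
        (Real.log (1 - 1 / ((k : ℝ) + 1 + n)) + 1 / ((k : ℝ) + 1 + n - i)) -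
      r (k + 1) *
        (Real.log (1 - 1 / ((k : ℝ) + 1 + n)) + 1 / ((k : ℝ) + 1 + n - (1 : ℕ))) =
      j * (r (k + 1) / (((k : ℝ) + n) * ((k : ℝ) + n - j))) := by
    intro k
    have hk : (0 : ℝ) ≤ k := k.cast_nonneg
    have h1 : (k : ℝ) + n ≠ 0 := by linarith
    have h2 : (k : ℝ) + n - j ≠ 0 := by linarith
    rw [show (k : ℝ) + 1 + n - i = k + n - j by rw [hj]; ring,
      show (k : ℝ) + 1 + n - (1 : ℕ) = k + n by push_cast; ring]
    field_simp
    ring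
  have hsd : Summable fun k : ℕ => r (k + 1) / (((k : ℝ) + n) * ((k : ℝ) + n - j)) := by
    have h := hsi.sub hs1
    simp only [hterm] at h
    exact (summable_mul_left_iff hj0.ne').mp h
  have hdiff : lam r n i - lam r n 1 =
      -(j * ∑' k : ℕ, r (k + 1) / (((k : ℝ) + n) * ((k : ℝ) + n - j))) := by
    rw [lam, lam, ← tsum_mul_left, ← tsum_congr hterm, hsi.tsum_sub hs1]
    ring
  have hlow : cn r n ≤ ∑' k : ℕ, r (k + 1) / (((k : ℝ) + n) * ((k : ℝ) + n - j)) := by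
    refine hs.tsum_le_tsum (fun k => ?_) hsd
    have hk : (0 : ℝ) ≤ k := k.cast_nonneg
    have h0 := (hr (k + 1) (by omega)).1
    have h2 : 0 < (k : ℝ) + n - j := by linarith
    have h1 : 0 < (k : ℝ) + n := by linarith
    rw [sq]
    gcongr
    linarith
  have hupp : ∑' k : ℕ, r (k + 1) / (((k : ℝ) + n) * ((k : ℝ) + n - j)) ≤
      (1 + j / (n - j)) * cn r n := by
    rw [cn, ← tsum_mul_left]
    refine hsd.tsum_le_tsum (fun k => ?_) (hs.mul_left _)
    have hk : (0 : ℝ) ≤ k := k.cast_nonneg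
    have h0 := (hr (k + 1) (by omega)).1
    have h1 : 0 < (k : ℝ) + n := by linarith
    have h2 : 0 < (k : ℝ) + n - j := by linarith
    have h3 : j / ((k : ℝ) + n - j) ≤ j / (n - j) := by
      gcongr
      linarith
    calc r (k + 1) / (((k : ℝ) + n) * ((k : ℝ) + n - j))
        = (1 + j / ((k : ℝ) + n - j)) * (r (k + 1) / ((k : ℝ) + n) ^ 2) := by
          field_simp
          ring
      _ ≤ _ := by gcongr
  rw [← hj, hdiff]
  set S := ∑' k : ℕ, r (k + 1) / (((k : ℝ) + n) * ((k : ℝ) + n - j))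
  rw [show (cn r n)⁻¹ * -(j * S) / -j - 1 = (S - cn r n) / cn r n by field_simp,
    abs_of_nonneg (div_nonneg (by linarith) hc.le), div_le_iff₀ hc]
  linarith

/-- If `m(n) = o(n)`, then `c(n)⁻¹ (λ_i(n) - λ_1(n)) = (-i+1)(1 + o(1))`
uniformly over `2 ≤ i ≤ m(n)`. -/
theorem picket_fence_uniform_relative_error
    (r : ℕ → ℕ → ℝ)
    (hr01 : ∀ n k : ℕ, 1 ≤ n → 1 ≤ k → r n k ∈ Set.Icc (0 : ℝ) 1)
    (hrmono : ∀ n : ℕ, 1 ≤ n → ∀ k j : ℕ, 1 ≤ k → k ≤ j → r n j ≤ r n k)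
    (hr1 : ∀ n : ℕ, 1 ≤ n → r n 1 = 1)
    (m : ℕ → ℕ) (hm2 : ∀ n, 2 ≤ m n) (hmn : ∀ n, 2 ≤ n → m n ≤ n)
    (hmo : Tendsto (fun n : ℕ => (m n : ℝ) / n) atTop (nhds 0)) :
    Tendsto (fun n : ℕ =>
      (Finset.Icc 2 (m n)).sup' (Finset.nonempty_Icc.mpr (hm2 n)) (fun i =>
        |(cn (r n) n)⁻¹ * (lam (r n) n i - lam (r n) n 1) / (-((i : ℝ) - 1)) - 1|))
      atTop (nhds 0) := by
  have hlim : Tendsto (fun n : ℕ => 2 * ((m n : ℝ) / n)) atTop (nhds 0) := by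
    simpa using hmo.const_mul 2
  have hsmall : ∀ᶠ n : ℕ in atTop, (m n : ℝ) / n < 1 / 2 :=
    hmo.eventually_lt_const (by norm_num)
  refine tendsto_of_tendsto_of_tendsto_of_le_of_le' tendsto_const_nhds hlim
    (Eventually.of_forall fun n => ?_) ?_
  · exact (Finset.le_sup'_iff _).mpr ⟨2, Finset.mem_Icc.mpr ⟨le_rfl, hm2 n⟩, abs_nonneg _⟩
  · filter_upwards [hsmall, eventually_ge_atTop 2] with n hn hn2
    refine Finset.sup'_le _ _ fun i hi => ?_
    obtain ⟨hi2, him⟩ := Finset.mem_Icc.mp hi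
    have hn0 : (0 : ℝ) < n := by positivity
    have him' : (i : ℝ) ≤ m n := by exact_mod_cast him
    have hi2' : (2 : ℝ) ≤ i := by exact_mod_cast hi2
    rw [div_lt_iff₀ hn0] at hn
    refine (abs_lam_sub_lam_div_sub_one_le (hr01 n · (by omega)) (hr1 n (by omega)) hi2
      (him.trans (hmn n hn2))).trans ?_
    calc ((i : ℝ) - 1) / (n - (i - 1)) ≤ m n / (n / 2) := by
          gcongr <;> linarith
      _ = 2 * ((m n : ℝ) / n) := by ring

end
end

section
/- Fix n ≥ 1 and a real ĉ > 0, and let (L_τ)_{τ≥1} be a sequence of integers with L_τ > n for all τ, such that (L_τ − n)_{τ≥1} is frequency-convergent with limiting frequencies r(k). Then, as T → ∞, the functions u ↦ ∏_{τ=1}^T ∏_{k=1}^{L_τ − n} e^{ĉ/(kT)} · (u + ĉ/T − k)/(u − k) converge to the function u ↦ ∏_{k=1}^∞ exp( ĉ · r(k) · ( 1/k + 1/(u − k) ) ), uniformly on every compact subset of ℂ ∖ ℤ_{>0}. -/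
open MeasureTheory ProbabilityTheory Matrix Filter

noncomputable section

/-- A double product over the cells of a diagram with row lengths `ℓ`, reorganised by columns. -/
lemma prod_prod_Icc_eq_prod_range_pow {M : Type*} [CommMonoid M] (a : ℕ → M) (ℓ : ℕ → ℕ)
    (s : Finset ℕ) {B : ℕ} (hB : ∀ τ ∈ s, ℓ τ ≤ B) :
    ∏ τ ∈ s, ∏ k ∈ Finset.Icc 1 (ℓ τ), a k =
      ∏ k ∈ Finset.range B, a (k + 1) ^ (s.filter fun τ => k + 1 ≤ ℓ τ).card := by
  have hrow : ∀ τ ∈ s, ∏ k ∈ Finset.Icc 1 (ℓ τ), a k =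
      ∏ k ∈ Finset.range B, if k + 1 ≤ ℓ τ then a (k + 1) else 1 := by
    intro τ hτ
    rw [← Finset.prod_filter]
    refine Finset.prod_nbij' (fun k => k - 1) (fun k => k + 1) ?_ ?_ ?_ ?_ ?_
    · intro k hk
      have := hB τ hτ
      simp only [Finset.mem_Icc, Finset.mem_filter, Finset.mem_range] at hk ⊢
      omega
    · intro k hk
      simp only [Finset.mem_Icc, Finset.mem_filter, Finset.mem_range] at hk ⊢
      omega
    · intro k hk
      simp only [Finset.mem_Icc] at hk
      omega
    · intro k hk
      omega
    · intro k hk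
      simp only [Finset.mem_Icc] at hk
      rw [Nat.sub_add_cancel hk.1]
  rw [Finset.prod_congr rfl hrow, Finset.prod_comm]
  refine Finset.prod_congr rfl fun k _ => ?_
  rw [← Finset.prod_filter, Finset.prod_const]

/-- A compact set avoiding the positive integers stays at distance at least `d * k` from each
positive integer `k`, for some `d > 0`. -/
lemma IsCompact.exists_pos_mul_le_norm_sub_natCast {K : Set ℂ} (hK : IsCompact K)
    (h : ∀ z ∈ K, ∀ m : ℕ, 1 ≤ m → z ≠ (m : ℂ)) :
    ∃ d : ℝ, 0 < d ∧ ∀ u ∈ K, ∀ k : ℕ, d * ((k : ℝ) + 1) ≤ ‖u - ((k : ℂ) + 1)‖ := by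
  obtain ⟨M, hM0, hM⟩ := hK.isBounded.exists_pos_norm_le
  have hfin : ∀ N : ℕ, ∃ d : ℝ, 0 < d ∧ ∀ u ∈ K, ∀ k < N,
      d * ((k : ℝ) + 1) ≤ ‖u - ((k : ℂ) + 1)‖ := by
    intro N
    induction N with
    | zero => exact ⟨1, one_pos, by simp⟩
    | succ N ih =>
      obtain ⟨d, hd, hdN⟩ := ih
      obtain ⟨e, he, heN⟩ := hK.exists_forall_le'
        (f := fun u : ℂ => ‖u - ((N : ℂ) + 1)‖) (by fun_prop) (a := 0) (by
          intro u hu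
          rw [norm_pos_iff, sub_ne_zero]
          exact_mod_cast h u hu (N + 1) (by omega))
      refine ⟨min d (e / ((N : ℝ) + 1)), by positivity, fun u hu k hk => ?_⟩
      rcases Nat.lt_succ_iff_lt_or_eq.mp hk with hlt | rfl
      · exact (mul_le_mul_of_nonneg_right (min_le_left _ _) (by positivity)).trans (hdN u hu k hlt)
      · refine (mul_le_mul_of_nonneg_right (min_le_right _ _) (by positivity)).trans ?_
        rw [div_mul_cancel₀ _ (by positivity)]
        exact heN u hu
  obtain ⟨N, hN⟩ := exists_nat_ge (2 * M)
  obtain ⟨d, hd, hdN⟩ := hfin N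
  refine ⟨min d (1 / 2), by positivity, fun u hu k => ?_⟩
  rcases lt_or_ge k N with hlt | hge
  · exact (mul_le_mul_of_nonneg_right (min_le_left _ _) (by positivity)).trans (hdN u hu k hlt)
  · refine (mul_le_mul_of_nonneg_right (min_le_right _ _) (by positivity)).trans ?_
    have hcast : (N : ℝ) ≤ k := by exact_mod_cast hge
    have hnorm : ‖(k : ℂ) + 1‖ = (k : ℝ) + 1 := by exact_mod_cast Complex.norm_natCast (k + 1)
    have := norm_sub_norm_le ((k : ℂ) + 1) u
    rw [norm_sub_rev, hnorm] at this
    linarith [hM u hu]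

lemma summable_const_div_nat_add_one_sq (C : ℝ) :
    Summable fun k : ℕ => C / ((k : ℝ) + 1) ^ 2 := by
  have := (summable_nat_add_iff 1).mpr (Real.summable_nat_pow_inv.mpr one_lt_two)
  simpa [div_eq_mul_inv] using this.mul_left C

lemma norm_one_div_add_one_div_sub_le {d M : ℝ} (hd : 0 < d) {u : ℂ} (hu : ‖u‖ ≤ M) {k : ℕ}
    (hk : d * ((k : ℝ) + 1) ≤ ‖u - ((k : ℂ) + 1)‖) :
    ‖1 / ((k : ℂ) + 1) + 1 / (u - ((k : ℂ) + 1))‖ ≤ M / d / ((k : ℝ) + 1) ^ 2 := by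
  have hk0 : (0 : ℝ) < (k : ℝ) + 1 := by positivity
  have hnorm : ‖(k : ℂ) + 1‖ = (k : ℝ) + 1 := by exact_mod_cast Complex.norm_natCast (k + 1)
  have hpos : 0 < ‖u - ((k : ℂ) + 1)‖ := (mul_pos hd hk0).trans_le hk
  have h1 : (k : ℂ) + 1 ≠ 0 := norm_pos_iff.mp (hnorm ▸ hk0)
  have h2 : u - ((k : ℂ) + 1) ≠ 0 := norm_pos_iff.mp hpos
  have heq : 1 / ((k : ℂ) + 1) + 1 / (u - ((k : ℂ) + 1)) =
      u / (((k : ℂ) + 1) * (u - ((k : ℂ) + 1))) := by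
    field_simp
    ring
  rw [heq, norm_div, norm_mul, hnorm, div_div]
  have hM : 0 ≤ M := (norm_nonneg u).trans hu
  refine div_le_div₀ hM hu (by positivity) ?_
  calc d * ((k : ℝ) + 1) ^ 2 = ((k : ℝ) + 1) * (d * ((k : ℝ) + 1)) := by ring
    _ ≤ _ := by gcongr

lemma norm_log_one_add_sub_self_le_sq {z : ℂ} (hz : ‖z‖ ≤ 1 / 2) :
    ‖Complex.log (1 + z) - z‖ ≤ ‖z‖ ^ 2 := by
  refine (Complex.norm_log_one_add_sub_self_le (by linarith)).trans ?_
  have : (1 - ‖z‖)⁻¹ ≤ 2 := by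
    rw [inv_le_comm₀ (by linarith) two_pos]
    linarith
  nlinarith [sq_nonneg ‖z‖]

/-- Pointwise comparison between the logarithm of the `k`-th column of the prelimit product and
the exponent of the `k`-th factor of the limit. -/
lemma norm_column_log_sub_le {c d M : ℝ} (hc : 0 ≤ c) (hd : 0 < d) {u : ℂ} (hu : ‖u‖ ≤ M)
    {k : ℕ} (hk : d * ((k : ℝ) + 1) ≤ ‖u - ((k : ℂ) + 1)‖) {T N : ℕ} (hT : 0 < T) (hNT : N ≤ T)
    (hTd : 2 * c ≤ d * T) (ρ : ℝ) :
    ‖(N : ℂ) * ((c : ℂ) / (((k : ℂ) + 1) * T) +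
          Complex.log (1 + (c : ℂ) / (T * (u - ((k : ℂ) + 1))))) -
        (c : ℂ) * (ρ : ℂ) * (1 / ((k : ℂ) + 1) + 1 / (u - ((k : ℂ) + 1)))‖ ≤
      (c * (M / d) * |(N : ℝ) / T - ρ| + c ^ 2 / d ^ 2 / T) / ((k : ℝ) + 1) ^ 2 ∧
    ‖(c : ℂ) / (T * (u - ((k : ℂ) + 1)))‖ ≤ 1 / 2 := by
  have hk0 : (0 : ℝ) < (k : ℝ) + 1 := by positivity
  have hT0 : (0 : ℝ) < T := by exact_mod_cast hT
  have hTC : (T : ℂ) ≠ 0 := by exact_mod_cast hT.ne'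
  have hpos : 0 < ‖u - ((k : ℂ) + 1)‖ := (mul_pos hd hk0).trans_le hk
  have h1 : (k : ℂ) + 1 ≠ 0 := by exact_mod_cast k.succ_ne_zero
  have h2 : u - ((k : ℂ) + 1) ≠ 0 := norm_pos_iff.mp hpos
  set z : ℂ := (c : ℂ) / (T * (u - ((k : ℂ) + 1))) with hzdef
  have hz : ‖z‖ ≤ c / (T * (d * ((k : ℝ) + 1))) := by
    rw [hzdef, norm_div, norm_mul, Complex.norm_natCast, Complex.norm_real, Real.norm_of_nonneg hc]
    gcongr
  have hz' : ‖z‖ ≤ 1 / 2 := by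
    refine hz.trans ?_
    rw [div_le_div_iff₀ (by positivity) two_pos]
    have : 0 ≤ (T : ℝ) * d * k := by positivity
    nlinarith
  refine ⟨?_, hz'⟩
  have hsplit : (N : ℂ) * ((c : ℂ) / (((k : ℂ) + 1) * T) + Complex.log (1 + z)) -
        (c : ℂ) * (ρ : ℂ) * (1 / ((k : ℂ) + 1) + 1 / (u - ((k : ℂ) + 1))) =
      (c : ℂ) * (((N : ℝ) / T - ρ : ℝ) : ℂ) * (1 / ((k : ℂ) + 1) + 1 / (u - ((k : ℂ) + 1))) +
        (N : ℂ) * (Complex.log (1 + z) - z) := by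
    rw [hzdef]
    push_cast
    field_simp
    ring
  rw [hsplit, add_div]
  refine (norm_add_le _ _).trans (add_le_add ?_ ?_)
  · rw [norm_mul, norm_mul, Complex.norm_real, Complex.norm_real, Real.norm_of_nonneg hc,
      Real.norm_eq_abs]
    calc c * |(N : ℝ) / T - ρ| * ‖1 / ((k : ℂ) + 1) + 1 / (u - ((k : ℂ) + 1))‖
        ≤ c * |(N : ℝ) / T - ρ| * (M / d / ((k : ℝ) + 1) ^ 2) := by
          gcongr
          exact norm_one_div_add_one_div_sub_le hd hu hk
      _ = _ := by ring
  · rw [norm_mul, Complex.norm_natCast]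
    calc (N : ℝ) * ‖Complex.log (1 + z) - z‖
        ≤ T * (c / (T * (d * ((k : ℝ) + 1)))) ^ 2 := by
          gcongr
          exact (norm_log_one_add_sub_self_le_sq hz').trans (by gcongr)
      _ = _ := by field_simp

/-- Uniform-on-compacts convergence of the `T`-th root factors to an
infinite product, for a frequency-convergent sequence. -/
theorem tau_product_converges
    (n : ℕ) (hn : 1 ≤ n) (chat : ℝ) (hchat : 0 < chat)
    (Lseq : ℕ → ℕ) (hL : ∀ τ, 1 ≤ τ → n < Lseq τ)
    (r : ℕ → ℝ)
    (hfreq : ∀ k : ℕ, 1 ≤ k → Tendsto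
      (fun T : ℕ => (((Finset.Icc 1 T).filter fun τ => k ≤ Lseq τ - n).card : ℝ) / T)
      atTop (nhds (r k)))
    (K : Set ℂ) (hKcompact : IsCompact K)
    (hK : ∀ z ∈ K, ∀ m : ℕ, 1 ≤ m → z ≠ (m : ℂ)) :
    TendstoUniformlyOn
      (fun (T : ℕ) (u : ℂ) => ∏ τ ∈ Finset.Icc 1 T, ∏ k ∈ Finset.Icc 1 (Lseq τ - n),
        Complex.exp ((chat : ℂ) / (k * T)) * ((u + (chat : ℂ) / T - k) / (u - k)))
      (fun u : ℂ => ∏' k : ℕ,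
        Complex.exp ((chat : ℂ) * (r (k + 1) : ℝ) *
          (1 / ((k : ℂ) + 1) + 1 / (u - ((k : ℂ) + 1)))))
      atTop K := by
  obtain ⟨d, hd, hdK⟩ := hKcompact.exists_pos_mul_le_norm_sub_natCast hK
  obtain ⟨M, hM0, hM⟩ := hKcompact.isBounded.exists_pos_norm_le
  set ℓ : ℕ → ℕ := fun τ => Lseq τ - n
  set N : ℕ → ℕ → ℕ := fun T k => ((Finset.Icc 1 T).filter fun τ => k + 1 ≤ ℓ τ).card
  have hNle (T k : ℕ) : N T k ≤ T := (Finset.card_filter_le _ _).trans (by simp)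
  have hr (k : ℕ) : Tendsto (fun T : ℕ => (N T k : ℝ) / T) atTop (nhds (r (k + 1))) :=
    hfreq (k + 1) (by omega)
  have hfrac (T k : ℕ) : (N T k : ℝ) / T ∈ Set.Icc (0 : ℝ) 1 :=
    ⟨by positivity, div_le_one_of_le₀ (by exact_mod_cast hNle T k) (by positivity)⟩
  have hr01 (k : ℕ) : r (k + 1) ∈ Set.Icc (0 : ℝ) 1 :=
    isClosed_Icc.mem_of_tendsto (hr k) (Eventually.of_forall fun T => hfrac T k)
  set f : ℕ → ℕ → ℂ → ℂ := fun T k u => (N T k : ℂ) * ((chat : ℂ) / (((k : ℂ) + 1) * T) +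
    Complex.log (1 + (chat : ℂ) / (T * (u - ((k : ℂ) + 1))))) with hf
  set g : ℕ → ℂ → ℂ := fun k u => (chat : ℂ) * (r (k + 1) : ℝ) *
    (1 / ((k : ℂ) + 1) + 1 / (u - ((k : ℂ) + 1))) with hg
  set e : ℕ → ℕ → ℝ := fun T k => (chat * (M / d) * |(N T k : ℝ) / T - r (k + 1)| +
    chat ^ 2 / d ^ 2 / T) / ((k : ℝ) + 1) ^ 2
  have hgbound (u : ℂ) (hu : u ∈ K) (k : ℕ) :
      ‖g k u‖ ≤ chat * (M / d) / ((k : ℝ) + 1) ^ 2 := by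
    simp only [hg]
    rw [norm_mul, norm_mul, Complex.norm_real, Complex.norm_real, Real.norm_of_nonneg hchat.le,
      Real.norm_of_nonneg (hr01 k).1]
    calc chat * r (k + 1) * ‖1 / ((k : ℂ) + 1) + 1 / (u - ((k : ℂ) + 1))‖
        ≤ chat * 1 * (M / d / ((k : ℝ) + 1) ^ 2) := by
          gcongr
          · exact (hr01 k).2
          · exact norm_one_div_add_one_div_sub_le hd (hM u hu) (hdK u hu k)
      _ = _ := by ring
  have hgsum (u : ℂ) (hu : u ∈ K) : Summable fun k => g k u :=
    (summable_const_div_nat_add_one_sq _).of_norm_bounded (hgbound u hu)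
  have hfsupp (T : ℕ) : ∃ B : ℕ, (∀ τ ∈ Finset.Icc 1 T, ℓ τ ≤ B) ∧
      ∀ u, ∀ k ∉ Finset.range B, f T k u = 0 := by
    refine ⟨(Finset.Icc 1 T).sup ℓ, fun τ hτ => Finset.le_sup hτ, fun u k hk => ?_⟩
    have : N T k = 0 := by
      rw [Finset.card_eq_zero, Finset.filter_eq_empty_iff]
      intro τ hτ
      have := Finset.le_sup (f := ℓ) hτ
      rw [Finset.mem_range] at hk
      omega
    simp [hf, this]
  have hlarge : ∀ᶠ T : ℕ in atTop, 0 < T ∧ 2 * chat ≤ d * T := by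
    refine (eventually_gt_atTop 0).and ?_
    exact (tendsto_natCast_atTop_atTop.const_mul_atTop hd).eventually_ge_atTop (2 * chat)
  have hebound (T k : ℕ) (hT : 0 < T) :
      ‖e T k‖ ≤ (chat * (M / d) + chat ^ 2 / d ^ 2) / ((k : ℝ) + 1) ^ 2 := by
    have hT1 : (1 : ℝ) ≤ T := by exact_mod_cast hT
    have habs : |(N T k : ℝ) / T - r (k + 1)| ≤ 1 := by
      rw [abs_sub_le_iff]
      constructor <;> linarith [(hfrac T k).1, (hfrac T k).2, (hr01 k).1, (hr01 k).2]
    rw [Real.norm_of_nonneg (by positivity)]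
    exact div_le_div_of_nonneg_right (add_le_add
      (mul_le_of_le_one_right (by positivity) habs) (div_le_self (by positivity) hT1))
      (by positivity)
  have hetend : Tendsto (fun T => ∑' k, e T k) atTop (nhds 0) := by
    have := tendsto_tsum_of_dominated_convergence (f := e) (g := fun _ => 0) (𝓕 := atTop)
      (summable_const_div_nat_add_one_sq (chat * (M / d) + chat ^ 2 / d ^ 2)) ?_
      (hlarge.mono fun T hT k => hebound T k hT.1)
    · simpa using this
    · intro k
      have h1 : Tendsto (fun T : ℕ => |(N T k : ℝ) / T - r (k + 1)|) atTop (nhds 0) := by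
        simpa using ((hr k).sub_const (r (k + 1))).abs
      have h2 := tendsto_const_div_atTop_nhds_zero_nat (chat ^ 2 / d ^ 2)
      simpa using ((h1.const_mul (chat * (M / d))).add h2).div_const (((k : ℝ) + 1) ^ 2)
  have hunif : TendstoUniformlyOn (fun T u => ∑' k, f T k u) (fun u => ∑' k, g k u) atTop K := by
    rw [Metric.tendstoUniformlyOn_iff]
    intro ε hε
    filter_upwards [hlarge, hetend.eventually_lt_const hε] with T hT hlt u hu
    obtain ⟨B, -, hB⟩ := hfsupp T
    have hfsum : Summable fun k => f T k u := summable_of_ne_finset_zero (hB u)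
    have hesum : Summable (e T) :=
      (summable_const_div_nat_add_one_sq _).of_norm_bounded fun k => hebound T k hT.1
    rw [dist_comm, dist_eq_norm, ← hfsum.tsum_sub (hgsum u hu)]
    refine (tsum_of_norm_bounded hesum.hasSum fun k => ?_).trans_lt hlt
    exact (norm_column_log_sub_le hchat.le hd (hM u hu) (hdK u hu k) hT.1 (hNle T k) hT.2 _).1
  have hexp := hunif.comp_cexp (by
    refine ⟨∑' k : ℕ, chat * (M / d) / ((k : ℝ) + 1) ^ 2, ?_⟩
    rintro _ ⟨u, hu, rfl⟩
    exact (Complex.re_le_norm _).trans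
      (tsum_of_norm_bounded (summable_const_div_nat_add_one_sq _).hasSum (hgbound u hu)))
  refine (hexp.congr ?_).congr_right ?_
  · filter_upwards [hlarge] with T hT u hu
    obtain ⟨B, hℓB, hB⟩ := hfsupp T
    simp only [Function.comp_apply]
    rw [tsum_eq_sum (hB u), Complex.exp_sum,
      prod_prod_Icc_eq_prod_range_pow _ (fun τ => Lseq τ - n) _ hℓB]
    refine Finset.prod_congr rfl fun k _ => ?_
    have hz := (norm_column_log_sub_le hchat.le hd (hM u hu) (hdK u hu k) hT.1 (hNle T k) hT.2 0).2
    have hne : 1 + (chat : ℂ) / (T * (u - ((k : ℂ) + 1))) ≠ 0 := by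
      intro h0
      rw [eq_neg_of_add_eq_zero_right h0, norm_neg, norm_one] at hz
      norm_num at hz
    have hTC : (T : ℂ) ≠ 0 := by exact_mod_cast hT.1.ne'
    have huk : u - ((k : ℂ) + 1) ≠ 0 :=
      norm_pos_iff.mp ((mul_pos hd (by positivity)).trans_le (hdK u hu k))
    simp only [hf]
    rw [Complex.exp_nat_mul, Complex.exp_add, Complex.exp_log hne]
    push_cast
    congr 3
    field_simp
    ring
  · intro u hu
    exact (hgsum u hu).hasSum.cexp.tprod_eq.symm

end
end
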